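/- Let ξ ∈ ℝ with −1/2 < ξ < 0 and let κ ∈ ℤ. Then (1/(2π))·∫_{−π}^{π} |sin θ|^{−2ξ−1}·e^{−iκθ} dθ = cos²(κπ/2)·π^{−1/2}·(Γ(−ξ)/Γ(1/2+ξ))·Γ(1/2+ξ+κ/2)/Γ(1/2−ξ+κ/2). -/

import Mathlib

open MeasureTheory
open Set

theorem image_one_sub_cos_div_two_Ioo :
    (fun θ : ℝ => (1 - Real.cos θ) / 2) '' Ioo 0 Real.pi = Ioo 0 1 := by
  ext y
  constructor
  · rintro ⟨θ, ⟨h0, hπ⟩, rfl⟩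
    have h1 : Real.cos θ < Real.cos 0 :=
      Real.strictAntiOn_cos ⟨le_rfl, Real.pi_pos.le⟩ ⟨h0.le, hπ.le⟩ h0
    have h2 : Real.cos Real.pi < Real.cos θ :=
      Real.strictAntiOn_cos ⟨h0.le, hπ.le⟩ ⟨Real.pi_pos.le, le_rfl⟩ hπ
    rw [Real.cos_zero] at h1
    rw [Real.cos_pi] at h2
    exact ⟨by linarith, by linarith⟩
  · rintro ⟨h0, h1⟩
    refine ⟨Real.arccos (1 - 2 * y), ⟨Real.arccos_pos.2 (by linarith), ?_⟩, ?_⟩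
    · refine lt_of_le_of_ne (Real.arccos_le_pi _) fun h => ?_
      have := Real.arccos_eq_pi.1 h
      linarith
    · simp only [Real.cos_arccos (x := 1 - 2 * y) (by linarith) (by linarith)]
      ring

theorem injOn_one_sub_cos_div_two :
    InjOn (fun θ : ℝ => (1 - Real.cos θ) / 2) (Ioo 0 Real.pi) := by
  intro x hx y hy h
  refine Real.injOn_cos (Ioo_subset_Icc_self hx) (Ioo_subset_Icc_self hy) ?_
  simp only at h
  linarith

theorem hasDerivWithinAt_one_sub_cos_div_two (s : Set ℝ) (θ : ℝ) :
    HasDerivWithinAt (fun θ : ℝ => (1 - Real.cos θ) / 2) (Real.sin θ / 2) s θ := by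
  have := (((Real.hasDerivAt_cos θ).const_sub 1).div_const 2).hasDerivWithinAt (s := s)
  simpa using this

theorem abs_deriv_smul_beta_integrand (a : ℝ) {θ : ℝ} (hθ : θ ∈ Ioo 0 Real.pi) :
    |Real.sin θ / 2| • ((((1 - Real.cos θ) / 2 : ℝ) : ℂ) ^ ((a : ℂ) - 1) *
      (1 - (((1 - Real.cos θ) / 2 : ℝ) : ℂ)) ^ ((a : ℂ) - 1)) =
    ((2 ^ (1 - 2 * a) : ℝ) : ℂ) * ((Real.sin θ ^ (2 * a - 1) : ℝ) : ℂ) := by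
  have hs : 0 < Real.sin θ := Real.sin_pos_of_mem_Ioo hθ
  obtain ⟨h0, h1⟩ : (1 - Real.cos θ) / 2 ∈ Ioo (0 : ℝ) 1 :=
    image_one_sub_cos_div_two_Ioo ▸ mem_image_of_mem _ hθ
  have hx : (1 - Real.cos θ) / 2 * (1 - (1 - Real.cos θ) / 2) = (Real.sin θ / 2) ^ (2 : ℝ) := by
    rw [Real.rpow_two]
    linarith [Real.sin_sq_add_cos_sq θ]
  rw [abs_of_pos (by positivity), Complex.real_smul, ← Complex.ofReal_one, ← Complex.ofReal_sub,
    ← Complex.ofReal_sub, ← Complex.ofReal_cpow h0.le, ← Complex.ofReal_cpow (by linarith),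
    ← Complex.ofReal_mul, ← Complex.ofReal_mul, ← Complex.ofReal_mul,
    ← Real.mul_rpow h0.le (by linarith), hx, ← Real.rpow_mul (by positivity)]
  congr 1
  nth_rewrite 1 [← Real.rpow_one (Real.sin θ / 2)]
  rw [← Real.rpow_add (by positivity), Real.div_rpow hs.le (by norm_num), div_eq_mul_inv,
    ← Real.rpow_neg (by norm_num), mul_comm]
  congr 2 <;> ring

theorem integrableOn_sin_rpow {a : ℝ} (ha : 0 < a) :
    IntegrableOn (fun θ => ((Real.sin θ ^ (2 * a - 1) : ℝ) : ℂ)) (Ioo 0 Real.pi) := by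
  have hb := Complex.betaIntegral_convergent (u := a) (v := a) (by simpa) (by simpa)
  rw [intervalIntegrable_iff_integrableOn_Ioo_of_le zero_le_one,
    ← image_one_sub_cos_div_two_Ioo, integrableOn_image_iff_integrableOn_abs_deriv_smul
      measurableSet_Ioo (fun θ _ => hasDerivWithinAt_one_sub_cos_div_two _ θ)
      injOn_one_sub_cos_div_two,
    integrableOn_congr_fun (fun θ hθ => abs_deriv_smul_beta_integrand a hθ) measurableSet_Ioo] at hb
  have h2 : ((2 ^ (1 - 2 * a) : ℝ) : ℂ) ≠ 0 := by
    exact_mod_cast (Real.rpow_pos_of_pos two_pos _).ne'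
  exact (integrable_const_mul_iff h2.isUnit _).1 hb

theorem integral_sin_rpow {a : ℝ} (ha : 0 < a) :
    ∫ θ in (0 : ℝ)..Real.pi, ((Real.sin θ ^ (2 * a - 1) : ℝ) : ℂ) =
      (Real.sqrt Real.pi : ℂ) * Complex.Gamma a / Complex.Gamma (a + 1 / 2) := by
  have hb := Complex.betaIntegral_eq_Gamma_mul_div a a (by simpa) (by simpa)
  rw [Complex.betaIntegral, intervalIntegral.integral_of_le zero_le_one,
    integral_Ioc_eq_integral_Ioo,
    ← image_one_sub_cos_div_two_Ioo, integral_image_eq_integral_abs_deriv_smul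
      measurableSet_Ioo (fun θ _ => hasDerivWithinAt_one_sub_cos_div_two _ θ)
      injOn_one_sub_cos_div_two,
    setIntegral_congr_fun measurableSet_Ioo (fun θ hθ => abs_deriv_smul_beta_integrand a hθ),
    integral_const_mul] at hb
  rw [intervalIntegral.integral_of_le Real.pi_pos.le, integral_Ioc_eq_integral_Ioo]
  have hd := Complex.Gamma_mul_Gamma_add_half a
  have h2 : ((2 ^ (1 - 2 * a) : ℝ) : ℂ) ≠ 0 := by
    exact_mod_cast (Real.rpow_pos_of_pos two_pos _).ne'
  have h3 : ((2 ^ (1 - 2 * a) : ℝ) : ℂ) = (2 : ℂ) ^ (1 - 2 * (a : ℂ)) := by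
    rw [Complex.ofReal_cpow (by norm_num)]
    push_cast
    rfl
  rw [← h3] at hd
  have hg : Complex.Gamma (a + 1 / 2) ≠ 0 :=
    Complex.Gamma_ne_zero_of_re_pos (by simp; positivity)
  have hg2 : Complex.Gamma (2 * a) ≠ 0 :=
    Complex.Gamma_ne_zero_of_re_pos (by simpa)
  rw [← two_mul, eq_div_iff hg2] at hb
  rw [eq_div_iff hg]
  apply mul_left_cancel₀ (mul_ne_zero h2 hg2)
  linear_combination Complex.Gamma (a + 1 / 2) * hb + Complex.Gamma a * hd

theorem intervalIntegrable_sin_rpow_mul_exp {a : ℝ} (ha : 0 < a) (c : ℂ) :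
    IntervalIntegrable (fun θ : ℝ => ((Real.sin θ ^ (2 * a - 1) : ℝ) : ℂ) *
      Complex.exp (-(c * θ) * Complex.I)) volume 0 Real.pi := by
  refine IntervalIntegrable.mul_continuousOn ?_ (by fun_prop)
  rw [intervalIntegrable_iff_integrableOn_Ioo_of_le Real.pi_pos.le]
  exact integrableOn_sin_rpow ha

theorem integral_sin_rpow_mul_exp_recurrence {a : ℝ} (ha : 0 < a) (c : ℂ) :
    (a + c + 1 / 2) * ∫ θ in (0 : ℝ)..Real.pi, ((Real.sin θ ^ (2 * a - 1) : ℝ) : ℂ) *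
        Complex.exp (-(2 * (c + 1) * θ) * Complex.I) =
      (c + 1 / 2 - a) * ∫ θ in (0 : ℝ)..Real.pi, ((Real.sin θ ^ (2 * a - 1) : ℝ) : ℂ) *
        Complex.exp (-(2 * c * θ) * Complex.I) := by
  have i1 := (intervalIntegrable_sin_rpow_mul_exp ha (2 * (c + 1))).const_mul (a + c + 1 / 2)
  have i2 := (intervalIntegrable_sin_rpow_mul_exp ha (2 * c)).const_mul (c + 1 / 2 - a)
  have key := intervalIntegral.integral_eq_sub_of_hasDerivAt_of_le Real.pi_pos.le
    (f := fun θ : ℝ => ((Real.sin θ ^ (2 * a) : ℝ) : ℂ) *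
      Complex.exp (-((2 * c + 1) * θ) * Complex.I)) ?_ ?_ (i1.sub i2)
  · simp only [Real.sin_pi, Real.sin_zero, Real.zero_rpow (by positivity : 2 * a ≠ 0),
      Complex.ofReal_zero, zero_mul, sub_zero] at key
    rw [intervalIntegral.integral_sub i1 i2, intervalIntegral.integral_const_mul,
      intervalIntegral.integral_const_mul] at key
    exact sub_eq_zero.1 key
  · refine Continuous.continuousOn ?_
    have : Continuous fun θ : ℝ => Real.sin θ ^ (2 * a) :=
      Real.continuous_sin.rpow_const fun _ => Or.inr (by positivity)
    fun_prop
  · intro θ hθ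
    have hs : 0 < Real.sin θ := Real.sin_pos_of_mem_Ioo hθ
    have d1 := ((Real.hasDerivAt_sin θ).rpow_const (p := 2 * a) (Or.inl hs.ne')).ofReal_comp
    have d2 : HasDerivAt (fun θ : ℝ => Complex.exp (-((2 * c + 1) * θ) * Complex.I))
        (Complex.exp (-((2 * c + 1) * θ) * Complex.I) * (-((2 * c + 1) * 1) * Complex.I)) θ :=
      ((((hasDerivAt_id θ).ofReal_comp.const_mul (2 * c + 1)).fun_neg).mul_const
        Complex.I).cexp
    refine (d1.mul d2).congr_deriv ?_
    have hp : Real.sin θ ^ (2 * a) = Real.sin θ ^ (2 * a - 1) * Real.sin θ := by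
      rw [Real.rpow_sub_one hs.ne', div_mul_cancel₀ _ hs.ne']
    have e1 : Complex.exp (-(2 * (c + 1) * θ) * Complex.I) =
        Complex.exp (-((2 * c + 1) * θ) * Complex.I) *
          (Complex.cos θ - Complex.sin θ * Complex.I) := by
      have h := Complex.exp_mul_I (-(θ : ℂ))
      rw [Complex.cos_neg, Complex.sin_neg, neg_mul (Complex.sin _), ← sub_eq_add_neg] at h
      rw [← h, ← Complex.exp_add]
      congr 1
      ring
    have e2 : Complex.exp (-(2 * c * θ) * Complex.I) =
        Complex.exp (-((2 * c + 1) * θ) * Complex.I) *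
          (Complex.cos θ + Complex.sin θ * Complex.I) := by
      rw [← Complex.exp_mul_I, ← Complex.exp_add]
      congr 1
      ring
    rw [hp, e1, e2]
    push_cast
    ring

theorem half_add_intCast_ne_intCast {b : ℝ} (hb : -(1 / 2) < b) (hb' : b < 1 / 2)
    (k m : ℤ) : 1 / 2 + (b : ℂ) + k ≠ m := by
  intro h
  have h' : 1 / 2 + b + k = m := by
    apply Complex.ofReal_injective
    push_cast
    exact h
  have h1 : (0 : ℝ) < ((m - k : ℤ) : ℝ) := by push_cast; linarith
  have h2 : ((m - k : ℤ) : ℝ) < (1 : ℤ) := by push_cast; linarith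
  have h1' : 0 < m - k := by exact_mod_cast h1
  have h2' : m - k < 1 := by exact_mod_cast h2
  omega

theorem Gamma_half_add_intCast_ne_zero {b : ℝ} (hb : -(1 / 2) < b) (hb' : b < 1 / 2)
    (k : ℤ) : Complex.Gamma (1 / 2 + (b : ℂ) + k) ≠ 0 :=
  Complex.Gamma_ne_zero fun m => by
    simpa using half_add_intCast_ne_intCast hb hb' k (-m)

theorem integral_sin_rpow_mul_exp {a : ℝ} (ha : 0 < a) (ha' : a < 1 / 2) (k : ℤ) :
    ∫ θ in (0 : ℝ)..Real.pi, ((Real.sin θ ^ (2 * a - 1) : ℝ) : ℂ) *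
        Complex.exp (-(2 * (k : ℂ) * θ) * Complex.I) =
      (Real.sqrt Real.pi : ℂ) * Complex.Gamma a / Complex.Gamma (1 / 2 - a) *
        (Complex.Gamma (1 / 2 - a + k) / Complex.Gamma (1 / 2 + a + k)) := by
  have hG (k : ℤ) := Gamma_half_add_intCast_ne_zero (b := a) (by linarith) ha' k
  have hG' (k : ℤ) : Complex.Gamma (1 / 2 - a + k) ≠ 0 := by
    simpa [sub_eq_add_neg] using
      Gamma_half_add_intCast_ne_zero (b := -a) (by linarith) (by linarith) k
  have hz (k : ℤ) : 1 / 2 + (a : ℂ) + k ≠ 0 := by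
    simpa using half_add_intCast_ne_intCast (b := a) (by linarith) ha' k 0
  have hz' (k : ℤ) : 1 / 2 - (a : ℂ) + k ≠ 0 := by
    simpa [sub_eq_add_neg] using half_add_intCast_ne_intCast (b := -a) (by linarith)
      (by linarith) k 0
  have hquot (k : ℤ) : (1 / 2 + (a : ℂ) + k) * (Complex.Gamma (1 / 2 - a + (k + 1 : ℤ)) /
      Complex.Gamma (1 / 2 + a + (k + 1 : ℤ))) =
      (1 / 2 - (a : ℂ) + k) * (Complex.Gamma (1 / 2 - a + k) / Complex.Gamma (1 / 2 + a + k)) := by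
    have h2 := hz k
    rw [Int.cast_add, Int.cast_one, ← add_assoc, ← add_assoc, Complex.Gamma_add_one _ (hz k),
      Complex.Gamma_add_one _ (hz' k), mul_div_assoc', mul_div_mul_left _ _ h2, mul_div_assoc]
  have hrec (k : ℤ) := integral_sin_rpow_mul_exp_recurrence ha (k : ℂ)
  induction k using Int.induction_on with
  | zero =>
    have h0' := hG' 0
    simp only [Int.cast_zero, add_zero] at h0'
    simp only [Int.cast_zero, add_zero, mul_zero, zero_mul, neg_zero, Complex.exp_zero, mul_one]
    rw [integral_sin_rpow ha, add_comm (a : ℂ), div_mul_div_cancel₀ h0']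
  | succ n ih =>
    have h := hrec n
    rw [ih] at h
    apply mul_left_cancel₀ (hz n)
    rw [mul_left_comm, hquot n]
    push_cast at h ⊢
    linear_combination h
  | pred n ih =>
    have h := hrec (-n - 1)
    have hq := hquot (-n - 1)
    rw [sub_add_cancel] at hq
    rw [show (((-n - 1 : ℤ) : ℂ) + 1) = ((-n : ℤ) : ℂ) by push_cast; ring, ih] at h
    apply mul_left_cancel₀ (hz' (-n - 1))
    rw [mul_left_comm, ← hq]
    linear_combination -h

theorem integral_abs_sin_rpow_mul_exp {a : ℝ} (ha : 0 < a) (κ : ℤ) :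
    ∫ θ in (-Real.pi)..Real.pi, ((|Real.sin θ| ^ (2 * a - 1) : ℝ) : ℂ) *
        Complex.exp (-((κ : ℂ) * θ) * Complex.I) =
      (1 + (-1) ^ κ) * ∫ θ in (0 : ℝ)..Real.pi, ((Real.sin θ ^ (2 * a - 1) : ℝ) : ℂ) *
        Complex.exp (-((κ : ℂ) * θ) * Complex.I) := by
  set f : ℝ → ℂ := fun θ => ((|Real.sin θ| ^ (2 * a - 1) : ℝ) : ℂ) *
    Complex.exp (-((κ : ℂ) * θ) * Complex.I) with hf
  have hcongr : EqOn f (fun θ => ((Real.sin θ ^ (2 * a - 1) : ℝ) : ℂ) *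
      Complex.exp (-((κ : ℂ) * θ) * Complex.I)) (uIcc 0 Real.pi) := by
    intro θ hθ
    rw [uIcc_of_le Real.pi_pos.le] at hθ
    simp only [hf, abs_of_nonneg (Real.sin_nonneg_of_mem_Icc hθ)]
  have hshift (θ : ℝ) : f (θ + Real.pi) = (-1) ^ κ * f θ := by
    have he : Complex.exp (-((κ : ℂ) * ((θ + Real.pi : ℝ) : ℂ)) * Complex.I) =
        (-1) ^ κ * Complex.exp (-((κ : ℂ) * θ) * Complex.I) := by
      have hpi : Complex.exp (-(Real.pi * Complex.I)) = -1 := by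
        rw [Complex.exp_neg, Complex.exp_pi_mul_I]
        norm_num
      rw [← hpi, ← Complex.exp_int_mul, ← Complex.exp_add]
      congr 1
      push_cast
      ring
    simp only [hf, he, Real.sin_add_pi, abs_neg]
    ring
  have hsq : ((-1 : ℂ) ^ κ) * (-1) ^ κ = 1 := by
    rw [← mul_zpow]
    norm_num
  have hf_int : IntervalIntegrable f volume 0 Real.pi :=
    (intervalIntegrable_sin_rpow_mul_exp ha κ).congr
      (fun θ hθ => (hcongr (uIoc_subset_uIcc hθ)).symm)
  have hshift' : f = fun θ => (-1) ^ κ * f (θ + Real.pi) := by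
    ext θ
    rw [hshift, ← mul_assoc, hsq, one_mul]
  have hf_int' : IntervalIntegrable f volume (-Real.pi) 0 := by
    rw [hshift']
    simpa using (hf_int.comp_add_right Real.pi).const_mul ((-1) ^ κ)
  have hneg : ∫ θ in (-Real.pi)..0, f θ = (-1) ^ κ * ∫ θ in (0 : ℝ)..Real.pi, f θ := by
    conv_lhs => rw [hshift']
    rw [intervalIntegral.integral_const_mul, intervalIntegral.integral_comp_add_right]
    simp
  rw [← intervalIntegral.integral_add_adjacent_intervals hf_int' hf_int, hneg,
    ← intervalIntegral.integral_congr hcongr]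
  ring

/-- for `-1/2 < ξ < 0` and `κ ∈ ℤ`,
`(1/(2π))∫_{-π}^{π} |sin θ|^{-2ξ-1} e^{-iκθ} dθ
  = cos²(κπ/2) π^{-1/2} (Γ(-ξ)/Γ(1/2+ξ)) Γ(1/2+ξ+κ/2)/Γ(1/2-ξ+κ/2)`. -/
theorem stmt_11 (ξ : ℝ) (h1 : -(1/2) < ξ) (h2 : ξ < 0) (κ : ℤ) :
    ((1 / (2 * Real.pi) : ℝ) : ℂ) * ∫ θ in (-Real.pi)..Real.pi,
        ((|Real.sin θ| ^ (-2 * ξ - 1) : ℝ) : ℂ) *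
          Complex.exp (-((κ : ℂ) * (θ : ℂ)) * Complex.I)
      = ((Real.cos ((κ : ℝ) * Real.pi / 2) ^ 2 : ℝ) : ℂ) *
          (Real.pi : ℂ) ^ (-(1/2) : ℂ) *
          (Complex.Gamma (-(ξ : ℂ)) / Complex.Gamma (1/2 + (ξ : ℂ))) *
          Complex.Gamma (1/2 + (ξ : ℂ) + (κ : ℂ)/2) /
          Complex.Gamma (1/2 - (ξ : ℂ) + (κ : ℂ)/2) := by
  have hmain := integral_abs_sin_rpow_mul_exp (a := -ξ) (by linarith) κ
  rw [show 2 * -ξ - 1 = -2 * ξ - 1 by ring] at hmain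
  rw [hmain]
  rcases Int.even_or_odd' κ with ⟨k, rfl | rfl⟩
  · have hk := integral_sin_rpow_mul_exp (a := -ξ) (by linarith) (by linarith) k
    rw [show 2 * -ξ - 1 = -2 * ξ - 1 by ring] at hk
    have hcos : Real.cos (((2 * k : ℤ) : ℝ) * Real.pi / 2) ^ 2 = 1 := by
      rw [show ((2 * k : ℤ) : ℝ) * Real.pi / 2 = k * Real.pi by push_cast; ring,
        Real.cos_int_mul_pi, ← zpow_natCast, zpow_comm]
      norm_num
    have hpi : (Real.pi : ℂ) ^ (-(1 / 2) : ℂ) = (Real.sqrt Real.pi : ℂ) / Real.pi := by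
      have h : (Real.pi : ℂ) ^ (-(1 / 2) : ℂ) = ((Real.pi ^ (-(1 / 2) : ℝ) : ℝ) : ℂ) := by
        rw [Complex.ofReal_cpow Real.pi_pos.le]
        push_cast
        rfl
      rw [h, Real.sqrt_eq_rpow, ← Complex.ofReal_div, ← Real.rpow_sub_one Real.pi_ne_zero]
      norm_num
    rw [hcos, hpi, zpow_mul]
    have hcast : ((2 * k : ℤ) : ℂ) = 2 * k := by push_cast; rfl
    rw [hcast, hk, mul_div_cancel_left₀ (k : ℂ) two_ne_zero]
    push_cast
    rw [sub_neg_eq_add, ← sub_eq_add_neg]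
    norm_num
    ring
  · have hcos : Real.cos (((2 * k + 1 : ℤ) : ℝ) * Real.pi / 2) = 0 :=
      Real.cos_eq_zero_iff.2 ⟨k, by push_cast; ring⟩
    have hodd : (-1 : ℂ) ^ (2 * k + 1) = -1 := Odd.neg_one_zpow ⟨k, rfl⟩
    rw [hcos, hodd]
    simp
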